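/- Let r ≥ 0 and s ≥ 1 be integers and let α = [0; a₁, …, a_r, overline{a_{r+1}, …, a_{r+s}}] ∈ F_q((T⁻¹)) be an ultimately periodic continued fraction (period a_{r+1}, …, a_{r+s}), with all partial quotients of positive degree. Then H(α) ≤ |q_r · q_{r+s}|, where q_n are the convergent denominators of α and H(α) is the height of α as a quadratic element over F_q(T). -/

import Mathlib

open Polynomial
open scoped Classical

noncomputable section

namespace CFq

variable (Fq : Type) [Field Fq] [Fintype Fq]

/-- The element `T` of `F_q((T⁻¹))`, realized as `X⁻¹` in the Laurent series field. -/
def Tls : LaurentSeries Fq := HahnSeries.single (-1 : ℤ) (1 : Fq)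

/-- The embedding of `F_q[T]` into `F_q((T⁻¹))`. -/
def toLS : Polynomial Fq →+* LaurentSeries Fq :=
  (Polynomial.aeval (Tls Fq)).toRingHom

/-- The absolute value `|ξ| = q^{-N}` where `ξ = Σ_{n ≥ N} a_n T^{-n}`, `a_N ≠ 0`. -/
def absQ (ξ : LaurentSeries Fq) : ℝ :=
  if ξ = 0 then 0 else (Fintype.card Fq : ℝ) ^ (-ξ.order)

/-- Absolute value of a polynomial in `T`:  `|f| = q^{deg f}`. -/
def pabs (f : Polynomial Fq) : ℝ := absQ Fq (toLS Fq f)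

/-- The height of a polynomial `P(X) ∈ (F_q[T])[X]`: the maximum of the absolute
values of its coefficients. -/
def Hpoly (P : Polynomial (Polynomial Fq)) : ℝ :=
  sSup {x : ℝ | ∃ i, x = pabs Fq (P.coeff i)}

/-- `ξ` has the (infinite) continued fraction expansion `[a₀; a₁, a₂, …]`, where all
partial quotients `aₙ`, `n ≥ 1`, have positive degree.  This is expressed via the
sequence of complete quotients (tails) `t n`, which satisfy `t n = a n + 1/(t (n+1))`
and `|t n| > 1` for `n ≥ 1`. -/
def IsCF (ξ : LaurentSeries Fq) (a : ℕ → Polynomial Fq) : Prop :=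
  (∀ n, 1 ≤ n → 1 ≤ (a n).natDegree) ∧
  ∃ t : ℕ → LaurentSeries Fq, t 0 = ξ ∧
    (∀ n, t n = toLS Fq (a n) + (t (n + 1))⁻¹) ∧
    (∀ n, 1 ≤ n → 1 < absQ Fq (t n))

/-- Denominators of the convergents: `q₀ = 1`, `q₁ = a₁`, `qₙ = aₙ q_{n-1} + q_{n-2}`. -/
def qden (a : ℕ → Polynomial Fq) : ℕ → Polynomial Fq
  | 0 => 1
  | 1 => a 1
  | n + 2 => a (n + 2) * qden a (n + 1) + qden a n

/-- Evaluation of `P(X) ∈ (F_q[T])[X]` at a Laurent series. -/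
def evalLS (P : Polynomial (Polynomial Fq)) (ξ : LaurentSeries Fq) : LaurentSeries Fq :=
  Polynomial.eval₂ (toLS Fq) ξ P

/-- The degree of an algebraic Laurent series over `F_q(T)`: the least degree of a
nonzero polynomial over `F_q[T]` annihilating it. -/
def degLS (ξ : LaurentSeries Fq) : ℕ :=
  sInf {d | ∃ P : Polynomial (Polynomial Fq), P ≠ 0 ∧ P.natDegree = d ∧ evalLS Fq P ξ = 0}

/-- The height of an algebraic Laurent series: the least height of a nonzero annihilating
polynomial of minimal degree (this is the height of the primitive minimal polynomial). -/
def heightLS (ξ : LaurentSeries Fq) : ℝ :=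
  sInf {x | ∃ P : Polynomial (Polynomial Fq),
    P ≠ 0 ∧ P.natDegree = degLS Fq ξ ∧ evalLS Fq P ξ = 0 ∧ x = Hpoly Fq P}

/-- The Diophantine exponent `w_n(ξ)`. -/
def wExp (n : ℕ) (ξ : LaurentSeries Fq) : EReal :=
  sSup ((fun w : ℝ => (w : EReal)) ''
    {w | {P : Polynomial (Polynomial Fq) | P.natDegree ≤ n ∧
      0 < absQ Fq (evalLS Fq P ξ) ∧
      absQ Fq (evalLS Fq P ξ) ≤ Hpoly Fq P ^ (-w)}.Infinite})

variable (L : Type) [Field L] [Algebra (LaurentSeries Fq) L]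

/-- The embedding of `F_q[T]` into a field extension `L` of `F_q((T⁻¹))`. -/
def embRing : Polynomial Fq →+* L :=
  (algebraMap (LaurentSeries Fq) L).comp (toLS Fq)

/-- Evaluation of `P(X) ∈ (F_q[T])[X]` at `α ∈ L`. -/
def evalA (P : Polynomial (Polynomial Fq)) (α : L) : L :=
  Polynomial.eval₂ (embRing Fq L) α P

/-- The degree of an algebraic `α ∈ L` over `F_q(T)`. -/
def degA (α : L) : ℕ :=
  sInf {d | ∃ P : Polynomial (Polynomial Fq), P ≠ 0 ∧ P.natDegree = d ∧ evalA Fq L P α = 0}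

/-- The height of an algebraic `α ∈ L`: the height of its primitive minimal polynomial
over `F_q[T]`. -/
def heightA (α : L) : ℝ :=
  sInf {x | ∃ P : Polynomial (Polynomial Fq),
    P ≠ 0 ∧ P.natDegree = degA Fq L α ∧ evalA Fq L P α = 0 ∧ x = Hpoly Fq P}

/-- `α ∈ L` is algebraic of degree at most `n` over `F_q(T)`. -/
def IsAlgDeg (n : ℕ) (α : L) : Prop :=
  ∃ P : Polynomial (Polynomial Fq), P ≠ 0 ∧ P.natDegree ≤ n ∧ evalA Fq L P α = 0

/-- The Diophantine exponent `w_n^*(ξ)`, computed with respect to an extension `L` of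
`F_q((T⁻¹))` (to be taken algebraically closed) endowed with an absolute value `v`
extending `absQ`. -/
def wstarExp (n : ℕ) (ξ : LaurentSeries Fq) (v : AbsoluteValue L ℝ) : EReal :=
  sSup ((fun w : ℝ => (w : EReal)) ''
    {w | {α : L | IsAlgDeg Fq L n α ∧
      0 < v (algebraMap (LaurentSeries Fq) L ξ - α) ∧
      v (algebraMap (LaurentSeries Fq) L ξ - α) ≤ heightA Fq L α ^ (-w - 1)}.Infinite})

end CFq

end
namespace CFq

section AbsoluteValue

variable {Fq : Type} [Field Fq]

lemma toLS_monomial (n : ℕ) (c : Fq) :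
    toLS Fq (monomial n c) = HahnSeries.single (-(n : ℤ)) c := by
  have hC : algebraMap Fq (LaurentSeries Fq) c = HahnSeries.single 0 c := by
    rw [HahnSeries.algebraMap_apply', PowerSeries.algebraMap_apply, Algebra.algebraMap_self,
      RingHom.id_apply, HahnSeries.ofPowerSeries_C]
    rfl
  change aeval (Tls Fq) (monomial n c) = _
  rw [aeval_monomial, hC, Tls, HahnSeries.single_pow, HahnSeries.single_mul_single]
  simp

lemma coeff_toLS (f : Fq[X]) (k : ℤ) :
    (toLS Fq f).coeff k = if k ≤ 0 then f.coeff (-k).toNat else 0 := by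
  induction f using Polynomial.induction_on' with
  | add f g hf hg =>
    rw [map_add, HahnSeries.coeff_add, hf, hg, Polynomial.coeff_add]
    split_ifs <;> simp
  | monomial n c =>
    rw [toLS_monomial, HahnSeries.coeff_single, Polynomial.coeff_monomial]
    grind

lemma toLS_injective : Function.Injective (toLS Fq) := by
  refine (injective_iff_map_eq_zero _).2 fun f hf => ?_
  ext n
  have h := coeff_toLS f (-(n : ℤ))
  rw [hf] at h
  simpa using h.symm

lemma toLS_ne_zero {f : Fq[X]} (hf : f ≠ 0) : toLS Fq f ≠ 0 :=
  (map_ne_zero_iff _ toLS_injective).2 hf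

lemma order_toLS {f : Fq[X]} (hf : f ≠ 0) : (toLS Fq f).order = -(f.natDegree : ℤ) := by
  apply le_antisymm
  · apply HahnSeries.order_le_of_coeff_ne_zero
    simpa [coeff_toLS] using hf
  · refine (HahnSeries.le_order_iff_forall (toLS_ne_zero hf)).2 fun k hk => ?_
    rw [coeff_toLS]
    split_ifs
    · exact Polynomial.coeff_eq_zero_of_natDegree_lt (by omega)
    · rfl

lemma order_inv {x : LaurentSeries Fq} (hx : x ≠ 0) : x⁻¹.order = -x.order := by
  have h := HahnSeries.order_mul hx (inv_ne_zero hx)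
  rw [mul_inv_cancel₀ hx, HahnSeries.order_one] at h
  omega

variable [Fintype Fq]

lemma one_lt_card : (1 : ℝ) < Fintype.card Fq := by
  exact_mod_cast Fintype.one_lt_card

lemma one_lt_absQ {x : LaurentSeries Fq} (h : 1 < absQ Fq x) : x ≠ 0 ∧ x.order < 0 := by
  unfold absQ at h
  split_ifs at h with hx
  · norm_num at h
  · rw [one_lt_zpow_iff_right₀ one_lt_card] at h
    exact ⟨hx, by omega⟩

lemma pabs_nonneg (f : Fq[X]) : 0 ≤ pabs Fq f := by
  unfold pabs absQ
  split_ifs <;> positivity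

lemma pabs_le_pabs {f g : Fq[X]} (h : f.degree ≤ g.degree) : pabs Fq f ≤ pabs Fq g := by
  rcases eq_or_ne f 0 with rfl | hf
  · simpa [pabs, absQ] using pabs_nonneg g
  have hg : g ≠ 0 := by
    rintro rfl
    simp_all
  unfold pabs absQ
  rw [if_neg (toLS_ne_zero hf), if_neg (toLS_ne_zero hg), order_toLS hf, order_toLS hg]
  refine zpow_le_zpow_right₀ one_lt_card.le ?_
  have := natDegree_le_natDegree h
  omega

end AbsoluteValue

section Continuants

variable {F : Type} [Field F]

/-- The solution of `u (n + 2) = a (n + 1) * u (n + 1) + u n` with `u 0 = x`, `u 1 = y`. -/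
noncomputable def contRec (a : ℕ → F[X]) (x y : F[X]) : ℕ → F[X]
  | 0 => x
  | 1 => y
  | n + 2 => a (n + 1) * contRec a x y (n + 1) + contRec a x y n

lemma contRec_add_two (a : ℕ → F[X]) (x y : F[X]) (n : ℕ) :
    contRec a x y (n + 2) = a (n + 1) * contRec a x y (n + 1) + contRec a x y n := by
  rw [contRec]

lemma contRec_eq_qden (a : ℕ → F[X]) : ∀ n, contRec a 0 1 (n + 1) = qden F a n
  | 0 => by simp [contRec, qden]
  | 1 => by simp [contRec, qden]
  | n + 2 => by
    rw [contRec_add_two, contRec_eq_qden a (n + 1), contRec_eq_qden a n, qden]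

lemma isCoprime_contRec (a : ℕ → F[X]) (n : ℕ) :
    IsCoprime (contRec a 0 1 n) (contRec a 0 1 (n + 1)) := by
  induction n with
  | zero => exact isCoprime_one_right
  | succ n ih =>
    rw [contRec_add_two]
    exact ih.symm.mul_add_right_right _

lemma degree_lt_degree_mul {f g : F[X]} (hf : 1 ≤ f.natDegree) (hg : g ≠ 0) :
    g.degree < (f * g).degree := by
  have hf0 : f ≠ 0 := by
    rintro rfl
    simp at hf
  rw [degree_mul, degree_eq_natDegree hf0, degree_eq_natDegree hg]
  norm_cast
  omega

lemma degree_contRec_lt {a : ℕ → F[X]} (ha : ∀ n, 1 ≤ n → 1 ≤ (a n).natDegree) (n : ℕ) :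
    (contRec a 0 1 n).degree < (contRec a 0 1 (n + 1)).degree := by
  induction n with
  | zero => simp [contRec]
  | succ n ih =>
    have hlt := degree_lt_degree_mul (ha (n + 1) (by omega)) (ne_zero_of_degree_gt ih)
    rwa [contRec_add_two, degree_add_eq_left_of_degree_lt (ih.trans hlt)]

lemma contRec_ne_zero {a : ℕ → F[X]} (ha : ∀ n, 1 ≤ n → 1 ≤ (a n).natDegree) (n : ℕ) :
    contRec a 0 1 (n + 1) ≠ 0 :=
  ne_zero_of_degree_gt (degree_contRec_lt ha n)

lemma degree_contRec_add_two {a : ℕ → F[X]} (ha : ∀ n, 1 ≤ n → 1 ≤ (a n).natDegree) (n : ℕ) :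
    (contRec a 0 1 (n + 2)).degree = (a (n + 1)).degree + (contRec a 0 1 (n + 1)).degree := by
  have h := (degree_contRec_lt ha n).trans
    (degree_lt_degree_mul (ha (n + 1) (by omega)) (contRec_ne_zero ha n))
  rw [contRec_add_two, degree_add_eq_left_of_degree_lt h, degree_mul]

lemma strictMono_degree_contRec {a : ℕ → F[X]} (ha : ∀ n, 1 ≤ n → 1 ≤ (a n).natDegree) :
    StrictMono fun n => (contRec a 0 1 n).degree :=
  strictMono_nat_of_lt_succ (degree_contRec_lt ha)

lemma degree_num_le {a : ℕ → F[X]} (ha : ∀ n, 1 ≤ n → 1 ≤ (a n).natDegree) (n : ℕ) :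
    (contRec a 1 0 (n + 1)).degree ≤ (contRec a 0 1 (n + 1)).degree ∧
      (contRec a 1 0 n).degree ≤ (contRec a 0 1 (n + 1)).degree := by
  induction n with
  | zero => simp [contRec]
  | succ n ih =>
    have hlt := degree_contRec_lt ha (n + 1)
    refine ⟨?_, ih.1.trans hlt.le⟩
    rw [contRec_add_two a 1 0]
    refine (degree_add_le _ _).trans (max_le ?_ (ih.2.trans hlt.le))
    rw [degree_contRec_add_two ha, degree_mul]
    gcongr
    exact ih.1

lemma contRec_cross_ne_zero {a : ℕ → F[X]} (ha : ∀ n, 1 ≤ n → 1 ≤ (a n).natDegree)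
    {m n : ℕ} (h : m < n) :
    contRec a 0 1 m * contRec a 0 1 (n + 1) - contRec a 0 1 n * contRec a 0 1 (m + 1) ≠ 0 := by
  intro h0
  have hdvd : contRec a 0 1 (n + 1) ∣ contRec a 0 1 (m + 1) := by
    refine (isCoprime_contRec a n).symm.dvd_of_dvd_mul_left ⟨contRec a 0 1 m, ?_⟩
    linear_combination -h0
  have hmono := strictMono_degree_contRec ha
  exact absurd (degree_le_of_dvd hdvd (contRec_ne_zero ha m)) (not_le.2 (hmono (by omega : m + 1 < n + 1)))

end Continuants

section Tails

variable {Fq : Type} [Field Fq] {a : ℕ → Fq[X]} {t u : ℕ → LaurentSeries Fq}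

lemma tails_unique (ht : ∀ n, t n = toLS Fq (a n) + (t (n + 1))⁻¹)
    (hu : ∀ n, u n = toLS Fq (a n) + (u (n + 1))⁻¹)
    (ht1 : ∀ n, t (n + 1) ≠ 0 ∧ (t (n + 1)).order < 0)
    (hu1 : ∀ n, u (n + 1) ≠ 0 ∧ (u (n + 1)).order < 0) : t 0 = u 0 := by
  have hsub (n : ℕ) : t n - u n = (t (n + 1))⁻¹ - (u (n + 1))⁻¹ := by
    rw [ht n, hu n]
    ring
  have hprod (n : ℕ) :
      t n - u n = -((t (n + 1) - u (n + 1)) * ((t (n + 1))⁻¹ * (u (n + 1))⁻¹)) := by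
    have h1 := (ht1 n).1
    have h2 := (hu1 n).1
    rw [hsub]
    field_simp
    ring
  have key (k : ℕ) : ∀ n, t n - u n ≠ 0 → (k : ℤ) ≤ (t n - u n).order := by
    induction k with
    | zero =>
      intro n hn
      rw [hsub, sub_eq_add_neg] at hn ⊢
      have h := HahnSeries.min_order_le_order_add hn
      rw [HahnSeries.order_neg, order_inv (ht1 n).1, order_inv (hu1 n).1] at h
      have := (ht1 n).2
      have := (hu1 n).2
      push_cast
      omega
    | succ k ih =>
      intro n hn
      rw [hprod] at hn ⊢
      have hn' : t (n + 1) - u (n + 1) ≠ 0 := by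
        rintro h
        simp [h] at hn
      have hi := inv_ne_zero (ht1 n).1
      have hj := inv_ne_zero (hu1 n).1
      rw [HahnSeries.order_neg, HahnSeries.order_mul hn' (mul_ne_zero hi hj),
        HahnSeries.order_mul hi hj, order_inv (ht1 n).1, order_inv (hu1 n).1]
      have := (ht1 n).2
      have := (hu1 n).2
      have := ih (n + 1) hn'
      push_cast
      omega
  by_contra h
  have := key ((t 0 - u 0).order.toNat + 1) 0 (sub_ne_zero.2 h)
  push_cast at this
  omega

lemma tails_irrational (ht : ∀ n, t n = toLS Fq (a n) + (t (n + 1))⁻¹)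
    (ht1 : ∀ n, t (n + 1) ≠ 0 ∧ (t (n + 1)).order < 0) (d : ℕ) :
    ∀ (n : ℕ) (f g : Fq[X]), f ≠ 0 → f.natDegree < d → toLS Fq f * t n ≠ toLS Fq g := by
  induction d with
  | zero => simp
  | succ d ih =>
    intro n f g hf hd h
    obtain ⟨hne, hord⟩ := ht1 n
    have hstep : toLS Fq (g - f * a n) * t (n + 1) = toLS Fq f := by
      rw [map_sub, map_mul, ← h, ht n]
      field_simp
      ring
    have hg : g - f * a n ≠ 0 := by
      intro h0
      rw [h0, map_zero, zero_mul] at hstep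
      exact toLS_ne_zero hf hstep.symm
    refine ih (n + 1) _ f hg ?_ hstep
    have := congrArg HahnSeries.order hstep
    rw [HahnSeries.order_mul (toLS_ne_zero hg) hne, order_toLS hg, order_toLS hf] at this
    omega

lemma contRec_tail (ht : ∀ n, t n = toLS Fq (a n) + (t (n + 1))⁻¹)
    (ht1 : ∀ n, t (n + 1) ≠ 0 ∧ (t (n + 1)).order < 0) (ha0 : a 0 = 0) (n : ℕ) :
    toLS Fq (contRec a 0 1 n) * t 0 - toLS Fq (contRec a 1 0 n) =
      -(t (n + 1) * (toLS Fq (contRec a 0 1 (n + 1)) * t 0 -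
        toLS Fq (contRec a 1 0 (n + 1)))) := by
  induction n with
  | zero =>
    have h := ht 0
    rw [ha0] at h
    have := (ht1 0).1
    simp [contRec, h, this]
  | succ n ih =>
    have h := ht (n + 1)
    have h2 := (ht1 (n + 1)).1
    have h3 : t (n + 1 + 1) * t (n + 1) = t (n + 1 + 1) * toLS Fq (a (n + 1)) + 1 := by
      rw [h]
      field_simp
    rw [contRec_add_two, contRec_add_two]
    simp only [map_add, map_mul]
    linear_combination (t (n + 1 + 1)) * ih - (toLS Fq (contRec a 0 1 (n + 1)) * t 0 -
        toLS Fq (contRec a 1 0 (n + 1))) * h3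

end Tails

section Height

variable {Fq : Type} [Field Fq] [Fintype Fq]

lemma heightLS_le_of_quadratic {α : LaurentSeries Fq} {A B C : Fq[X]} {M : ℝ}
    (hirr : ∀ f g : Fq[X], f ≠ 0 → toLS Fq f * α ≠ toLS Fq g) (hA : A ≠ 0)
    (hroot : toLS Fq A * α ^ 2 + toLS Fq B * α + toLS Fq C = 0)
    (hAM : pabs Fq A ≤ M) (hBM : pabs Fq B ≤ M) (hCM : pabs Fq C ≤ M) :
    heightLS Fq α ≤ M := by
  set P : Fq[X][X] := Polynomial.C A * X ^ 2 + Polynomial.C B * X + Polynomial.C C with hP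
  have hdeg : P.natDegree = 2 := natDegree_quadratic hA
  have hP0 : P ≠ 0 := by
    intro h
    simp [h] at hdeg
  have hPα : evalLS Fq P α = 0 := by
    simpa [evalLS, hP] using hroot
  have hdegLS : degLS Fq α = 2 := by
    refine le_antisymm (Nat.sInf_le ⟨P, hP0, hdeg, hPα⟩) ?_
    refine le_csInf ⟨2, P, hP0, hdeg, hPα⟩ ?_
    rintro d ⟨R, hR0, rfl, hR⟩
    by_contra! hlt
    obtain ⟨f, g, rfl⟩ := exists_eq_X_add_C_of_natDegree_le_one (p := R) (by omega)
    simp only [evalLS, eval₂_add, eval₂_mul, eval₂_C, eval₂_X] at hR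
    rcases eq_or_ne f 0 with rfl | hf
    · rw [map_zero, zero_mul, zero_add] at hR
      have hg : g = 0 := toLS_injective (hR.trans (map_zero _).symm)
      simp [hg] at hR0
    · refine hirr f (-g) hf ?_
      rw [map_neg]
      exact eq_neg_of_add_eq_zero_left hR
  have hH : Hpoly Fq P ≤ M := by
    refine csSup_le ⟨_, 0, rfl⟩ ?_
    rintro _ ⟨i, rfl⟩
    have h0 : pabs Fq (0 : Fq[X]) ≤ M := by
      simpa [pabs, absQ] using (pabs_nonneg A).trans hAM
    match i with
    | 0 => simpa [hP] using hCM
    | 1 => simpa [hP, coeff_X, coeff_C] using hBM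
    | 2 => simpa [hP, coeff_X, coeff_C] using hAM
    | i + 3 => rwa [coeff_eq_zero_of_natDegree_lt (by omega)]
  refine le_trans (csInf_le ⟨0, ?_⟩ ⟨P, hP0, hdeg.trans hdegLS.symm, hPα, rfl⟩) hH
  rintro _ ⟨R, -, -, -, rfl⟩
  refine Real.sSup_nonneg ?_
  rintro _ ⟨i, rfl⟩
  exact pabs_nonneg _

end Height

end CFq

/-- for an ultimately periodic continued fraction with preperiod `r` and
period `s`, `H(α) ≤ |q_r q_{r+s}|`. -/
theorem stmt4 (Fq : Type) [Field Fq] [Fintype Fq]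
    (r s : ℕ) (hs : 1 ≤ s) (a : ℕ → Polynomial Fq) (α : LaurentSeries Fq)
    (hcf : CFq.IsCF Fq α a) (ha0 : a 0 = 0)
    (hper : ∀ n, r + 1 ≤ n → a (n + s) = a n) :
    CFq.heightLS Fq α ≤ CFq.pabs Fq (CFq.qden Fq a r * CFq.qden Fq a (r + s)) := by
  open CFq in
  obtain ⟨ha, t, rfl, ht, ht1⟩ := hcf
  have htail (n : ℕ) := one_lt_absQ (ht1 (n + 1) (by omega))
  have haux (n : ℕ) : a (r + s + 1 + n) = a (r + 1 + n) := by
    rw [← hper (r + 1 + n) (by omega)]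
    congr 1
    omega
  have hβ : t (r + 1) = t (r + s + 1) :=
    tails_unique (a := fun n => a (r + 1 + n)) (t := fun n => t (r + 1 + n))
      (u := fun n => t (r + s + 1 + n)) (fun n => ht _) (fun n => haux n ▸ ht _)
      (fun n => htail _) (fun n => htail _)
  have hr := contRec_tail ht htail ha0 r
  have hrs := contRec_tail ht htail ha0 (r + s)
  rw [← hβ] at hrs
  have hirr (f g : Fq[X]) (hf : f ≠ 0) := tails_irrational ht htail _ 0 f g hf (Nat.lt_succ_self _)
  rw [← contRec_eq_qden, ← contRec_eq_qden]
  have hq (n : ℕ) := (degree_contRec_lt ha n).le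
  have hp (n : ℕ) := degree_num_le ha n
  have hsub {e f g h : Fq[X]} {x y : WithBot ℕ} (he : e.degree ≤ x) (hf : f.degree ≤ y)
      (hg : g.degree ≤ y) (hh : h.degree ≤ x) : (e * f - g * h).degree ≤ x + y := by
    refine (degree_sub_le _ _).trans (max_le ?_ ?_)
    · rw [degree_mul]
      exact add_le_add he hf
    · rw [degree_mul, add_comm]
      exact add_le_add hh hg
  refine heightLS_le_of_quadratic
    (A := contRec a 0 1 r * contRec a 0 1 (r + s + 1) -
      contRec a 0 1 (r + s) * contRec a 0 1 (r + 1))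
    (B := (contRec a 0 1 (r + 1) * contRec a 1 0 (r + s) -
      contRec a 0 1 (r + s + 1) * contRec a 1 0 r) +
      (contRec a 1 0 (r + 1) * contRec a 0 1 (r + s) -
      contRec a 1 0 (r + s + 1) * contRec a 0 1 r))
    (C := contRec a 1 0 r * contRec a 1 0 (r + s + 1) -
      contRec a 1 0 (r + s) * contRec a 1 0 (r + 1))
    hirr (contRec_cross_ne_zero ha (by omega)) ?_ ?_ ?_ ?_
  · simp only [map_add, map_sub, map_mul]
    linear_combination (toLS Fq (contRec a 0 1 (r + s + 1)) * t 0 -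
      toLS Fq (contRec a 1 0 (r + s + 1))) * hr -
      (toLS Fq (contRec a 0 1 (r + 1)) * t 0 - toLS Fq (contRec a 1 0 (r + 1))) * hrs
  all_goals
    apply pabs_le_pabs
    rw [degree_mul]
  · exact hsub (hq r) le_rfl (hq (r + s)) le_rfl
  · refine (degree_add_le _ _).trans (max_le ?_ ?_)
    · exact hsub le_rfl (hp (r + s)).2 le_rfl (hp r).2
    · exact hsub (hp r).1 (hq (r + s)) (hp (r + s)).1 (hq r)
  · exact hsub (hp r).2 (hp (r + s)).1 (hp (r + s)).2 (hp r).1
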